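/- arXiv:1704.07135 — 2 statements merged into one kernel-verified Lean document; each statement's English description precedes it below -/
import Mathlib

section
/- For all integers n ≥ i ≥ 1, in the field F_r(T) one has -∑_{d=0}^{i-1} (-1)^{i-d} / (L_{i-d}^{r^{n-i}} · D_d^{r^{n-d}}) = 1 / D_i^{r^{n-i}}. -/
noncomputable section

/-- `carlitzD Fq r i` is the Carlitz quantity `D_i = [i][i-1]^r ⋯ [1]^{r^{i-1}}`,
where `[i] = T^{r^i} - T`, viewed in the rational function field `Fq(T)`. -/
def carlitzD (Fq : Type*) [Field Fq] (r : ℕ) : ℕ → RatFunc Fq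
  | 0 => 1
  | (i + 1) => (RatFunc.X ^ r ^ (i + 1) - RatFunc.X) * (carlitzD Fq r i) ^ r

/-- `carlitzL Fq r i` is the Carlitz quantity `L_i = [i][i-1] ⋯ [1]`. -/
def carlitzL (Fq : Type*) [Field Fq] (r : ℕ) : ℕ → RatFunc Fq
  | 0 => 1
  | (i + 1) => (RatFunc.X ^ r ^ (i + 1) - RatFunc.X) * carlitzL Fq r i

theorem carlitz_br_ne (Fq : Type*) [Field Fq] (r : ℕ) (hr : 1 < r) (k : ℕ) :
    (RatFunc.X ^ r ^ (k + 1) - RatFunc.X : RatFunc Fq) ≠ 0 := by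
  have h1 : 1 < r ^ (k + 1) := Nat.one_lt_pow (by omega) hr
  intro h
  have h2 : algebraMap (Polynomial Fq) (RatFunc Fq)
      (Polynomial.X ^ r ^ (k + 1) - Polynomial.X) = 0 := by
    simpa using h
  rw [map_eq_zero_iff _ (RatFunc.algebraMap_injective Fq)] at h2
  exact FiniteField.X_pow_card_sub_X_ne_zero Fq h1 h2

theorem carlitzD_ne (Fq : Type*) [Field Fq] (r : ℕ) (hr : 1 < r) (k : ℕ) :
    carlitzD Fq r k ≠ 0 := by
  induction k with
  | zero => simp [carlitzD]
  | succ k ih => exact mul_ne_zero (carlitz_br_ne Fq r hr k) (pow_ne_zero _ ih)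

theorem carlitzL_ne (Fq : Type*) [Field Fq] (r : ℕ) (hr : 1 < r) (k : ℕ) :
    carlitzL Fq r k ≠ 0 := by
  induction k with
  | zero => simp [carlitzL]
  | succ k ih => exact mul_ne_zero (carlitz_br_ne Fq r hr k) ih

/-- the power map as a ring hom -/
theorem carlitz_frob (Fq : Type*) [Field Fq] [Fintype Fq] (r : ℕ) (hr : Fintype.card Fq = r)
    (j : ℕ) : ∃ φ : RatFunc Fq →+* RatFunc Fq, ∀ x, φ x = x ^ r ^ j := by
  obtain ⟨p, hp⟩ := CharP.exists Fq
  obtain ⟨f, hpp, hf⟩ := FiniteField.card Fq p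
  haveI : Fact p.Prime := ⟨hpp⟩
  haveI : CharP (RatFunc Fq) p := charP_of_injective_algebraMap
    (algebraMap Fq (RatFunc Fq)).injective p
  refine ⟨iterateFrobenius (RatFunc Fq) p (f * j), fun x => ?_⟩
  rw [iterateFrobenius_def, ← hr, hf, pow_mul]

theorem carlitz_partial (Fq : Type*) [Field Fq] [Fintype Fq] (r : ℕ)
    (hr : Fintype.card Fq = r) (m : ℕ) : ∀ j : ℕ,
    (RatFunc.X ^ r ^ (m + 1 + j) - RatFunc.X) * ∑ d ∈ Finset.range (m + 1),
        (-1) ^ (m + 1 + j - d) /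
          (carlitzL Fq r (m + 1 + j - d) * (carlitzD Fq r d) ^ r ^ (m + 1 + j - d))
      = - ((-1) ^ j / (carlitzL Fq r j * (carlitzD Fq r m) ^ r ^ (j + 1))) := by
  have h1 : 1 < r := hr ▸ Fintype.one_lt_card
  induction m with
  | zero =>
    intro j
    have hB := carlitz_br_ne Fq r h1 j
    have hL := carlitzL_ne Fq r h1 j
    simp only [zero_add, Finset.sum_range_one, Nat.sub_zero, carlitzD, one_pow, mul_one]
    rw [show 1 + j = j + 1 by omega, carlitzL]
    field_simp
    ring
  | succ m ih =>
    intro j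
    have hB := carlitz_br_ne Fq r h1 j
    have hBm := carlitz_br_ne Fq r h1 m
    have hL := carlitzL_ne Fq r h1 j
    have hD := carlitzD_ne Fq r h1 m
    have h := ih (j + 1)
    rw [show m + 1 + (j + 1) = m + 1 + 1 + j by omega] at h
    rw [Finset.sum_range_succ, mul_add, h, show m + 1 + 1 + j - (m + 1) = j + 1 by omega]
    have key : (RatFunc.X ^ r ^ (m + 1 + 1 + j) - RatFunc.X : RatFunc Fq)
        = (RatFunc.X ^ r ^ (m + 1) - RatFunc.X) ^ r ^ (j + 1)
          + (RatFunc.X ^ r ^ (j + 1) - RatFunc.X) := by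
      obtain ⟨φ, hφ⟩ := carlitz_frob Fq r hr (j + 1)
      rw [← hφ, map_sub, hφ, hφ, ← pow_mul, ← pow_add,
        show m + 1 + (j + 1) = m + 1 + 1 + j by omega]
      ring
    have e : (carlitzD Fq r (m + 1)) ^ r ^ (j + 1)
        = (RatFunc.X ^ r ^ (m + 1) - RatFunc.X) ^ r ^ (j + 1)
          * carlitzD Fq r m ^ r ^ (j + 1 + 1) := by
      rw [carlitzD, mul_pow, ← pow_mul, ← pow_succ']
    rw [key, e, carlitzL]
    have hP := pow_ne_zero (r ^ (j + 1)) hBm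
    have hQ := pow_ne_zero (r ^ (j + 1 + 1)) hD
    generalize (RatFunc.X ^ r ^ (m + 1) - RatFunc.X : RatFunc Fq) ^ r ^ (j + 1) = P at *
    generalize carlitzD Fq r m ^ r ^ (j + 1 + 1) = Q at *
    generalize (RatFunc.X ^ r ^ (j + 1) - RatFunc.X : RatFunc Fq) = B at *
    rw [pow_succ]
    field_simp
    ring

/-- For `1 ≤ i ≤ n`,
`-∑_{d=0}^{i-1} (-1)^{i-d} / (L_{i-d}^{r^{n-i}} D_d^{r^{n-d}}) = 1 / D_i^{r^{n-i}}`. -/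
theorem neg_sum_inv_carlitzL_pow_mul_carlitzD_pow
    (Fq : Type*) [Field Fq] [Fintype Fq] (r : ℕ) (hr : Fintype.card Fq = r)
    (n i : ℕ) (hi : 1 ≤ i) (hin : i ≤ n) :
    -∑ d ∈ Finset.range i,
        (-1) ^ (i - d) /
          ((carlitzL Fq r (i - d)) ^ r ^ (n - i) * (carlitzD Fq r d) ^ r ^ (n - d))
      = 1 / (carlitzD Fq r i) ^ r ^ (n - i) := by
  have h1 : 1 < r := hr ▸ Fintype.one_lt_card
  obtain ⟨k, rfl⟩ : ∃ k, i = k + 1 := ⟨i - 1, by omega⟩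
  have h := carlitz_partial Fq r hr k 0
  have hB := carlitz_br_ne Fq r h1 k
  have hD := carlitzD_ne Fq r h1 k
  simp only [add_zero, zero_add, pow_zero, pow_one, carlitzL, one_mul] at h
  have h2 : -∑ d ∈ Finset.range (k + 1), (-1) ^ (k + 1 - d) /
      (carlitzL Fq r (k + 1 - d) * (carlitzD Fq r d) ^ r ^ (k + 1 - d))
      = 1 / carlitzD Fq r (k + 1) := by
    apply mul_left_cancel₀ hB
    rw [mul_neg, h, carlitzD]
    field_simp
  obtain ⟨φ, hφ⟩ := carlitz_frob Fq r hr (n - (k + 1))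
  have h3 := congrArg φ h2
  simp only [map_neg, map_sum, map_div₀, map_mul, map_pow, map_one] at h3
  rw [hφ] at h3
  rw [← h3]
  congr 1
  refine Finset.sum_congr rfl fun d hd => ?_
  have := Finset.mem_range.1 hd
  rw [hφ, hφ, ← pow_mul, ← pow_add, show n - (k + 1) + (k + 1 - d) = n - d by omega]

end
end

section
/- For all integers N ≥ 1 and n ≥ 1, the hypergeometric Bernoulli number B_{N,n} satisfies B_{N,n} = n! ∑_{k=1}^{n} (-N!)^k ∑_{i_1,…,i_k ≥ 1, i_1+⋯+i_k = n} 1 / ((N+i_1)! (N+i_2)! ⋯ (N+i_k)!), where the inner sum is over all ordered k-tuples of positive integers summing to n. -/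
noncomputable section

/-- The power series `₁F₁(1; N+1; x) = ∑_{j≥0} N! x^j / (N + j)!` in `ℚ⟦x⟧`. -/
def hgBernoulliSeries (N : ℕ) : PowerSeries ℚ :=
  PowerSeries.mk fun j : ℕ => (N.factorial : ℚ) / ((N + j).factorial : ℚ)

/-- The hypergeometric Bernoulli number `B_{N,n}`: `n!` times the `n`-th coefficient of the
multiplicative inverse of `₁F₁(1; N+1; x)`. -/
def hgBernoulli (N n : ℕ) : ℚ :=
  (n.factorial : ℚ) * PowerSeries.coeff n (hgBernoulliSeries N)⁻¹

open PowerSeries in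
theorem coeff_pow_tuple (g : PowerSeries ℚ) (k n : ℕ) :
    coeff n (g ^ k) = ∑ i ∈ Finset.Nat.antidiagonalTuple k n, ∏ j, coeff (i j) g := by
  have h : g ^ k = ∏ _j : Fin k, g := by simp
  rw [h, coeff_prod]
  refine Finset.sum_bij' (fun l _ => (l : Fin k → ℕ))
    (fun i _ => Finsupp.equivFunOnFinite.symm i) ?_ ?_ ?_ ?_ ?_
  · intro l hl
    simpa [Finset.Nat.mem_antidiagonalTuple, Finset.mem_finsuppAntidiag] using hl
  · intro l hl
    simpa [Finset.Nat.mem_antidiagonalTuple, Finset.mem_finsuppAntidiag] using hl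
  · intro l hl
    ext; simp
  · intro l hl
    ext; simp
  · intro l hl
    rfl

open PowerSeries in
theorem coeff_one_sub_hg (N j : ℕ) : coeff j (1 - hgBernoulliSeries N) =
    if 1 ≤ j then -(N.factorial : ℚ) * (1 / ((N + j).factorial : ℚ)) else 0 := by
  have hf : (N.factorial : ℚ) ≠ 0 := by exact_mod_cast N.factorial_ne_zero
  rcases Nat.eq_zero_or_pos j with rfl | hj
  · simp only [map_sub, hgBernoulliSeries, coeff_mk, coeff_one]
    simp [hf]
  · have h0 : j ≠ 0 := by omega
    have h1 : 1 ≤ j := hj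
    simp only [map_sub, hgBernoulliSeries, coeff_mk, coeff_one, if_pos h1, if_neg h0]
    ring

/-- `B_{N,n} = n! ∑_{k=1}^n (-N!)^k ∑_{i_1+⋯+i_k=n, i_j ≥ 1} 1/((N+i_1)!⋯(N+i_k)!)`. -/
theorem hgBernoulli_eq_sum_pos_tuples (N n : ℕ) (hN : 1 ≤ N) (hn : 1 ≤ n) :
    hgBernoulli N n
      = (n.factorial : ℚ) *
          ∑ k ∈ Finset.Icc 1 n,
            (-(N.factorial : ℚ)) ^ k *
              ∑ i ∈ (Finset.Nat.antidiagonalTuple k n).filter fun i => ∀ j, 1 ≤ i j,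
                1 / ∏ j, ((N + i j).factorial : ℚ) := by
  have hf : (N.factorial : ℚ) ≠ 0 := by exact_mod_cast N.factorial_ne_zero
  unfold hgBernoulli
  congr 1
  set F := hgBernoulliSeries N with hF
  have hc : PowerSeries.constantCoeff F ≠ 0 := by
    rw [← PowerSeries.coeff_zero_eq_constantCoeff_apply, hF, hgBernoulliSeries,
      PowerSeries.coeff_mk]
    simp [hf]
  have hinv : F⁻¹ = ∑ k ∈ Finset.range (n + 1), (1 - F) ^ k + (1 - F) ^ (n + 1) * F⁻¹ := by
    have hg := mul_neg_geom_sum (1 - F) (n + 1)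
    have hm := PowerSeries.mul_inv_cancel F hc
    rw [sub_sub_cancel] at hg
    linear_combination (-F⁻¹) * hg + (∑ k ∈ Finset.range (n + 1), (1 - F) ^ k) * hm
  have hz : PowerSeries.coeff n ((1 - F) ^ (n + 1) * F⁻¹) = 0 := by
    have hd : (PowerSeries.X : PowerSeries ℚ) ∣ 1 - F := by
      rw [PowerSeries.X_dvd_iff, ← PowerSeries.coeff_zero_eq_constantCoeff_apply, hF,
        coeff_one_sub_hg]
      simp
    exact PowerSeries.X_pow_dvd_iff.mp ((pow_dvd_pow_of_dvd hd (n + 1)).mul_right _) n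
      (Nat.lt_succ_self n)
  rw [hinv, map_add, hz, add_zero, map_sum, Finset.range_eq_Ico,
    Finset.sum_eq_sum_Ico_succ_bot (Nat.succ_pos n)]
  have h0 : PowerSeries.coeff n ((1 - F) ^ 0) = 0 := by
    rw [pow_zero, PowerSeries.coeff_one, if_neg (by omega)]
  rw [h0, zero_add]
  have hI : Finset.Ico (0 + 1) (n + 1) = Finset.Icc 1 n := by
    ext x; simp only [Finset.mem_Ico, Finset.mem_Icc]; omega
  rw [hI]
  refine Finset.sum_congr rfl fun k _ => ?_
  rw [coeff_pow_tuple, Finset.sum_filter, Finset.mul_sum]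
  refine Finset.sum_congr rfl fun i _ => ?_
  simp only [hF, coeff_one_sub_hg]
  split_ifs with h
  · rw [Finset.prod_congr rfl fun j _ => if_pos (h j), Finset.prod_mul_distrib]
    simp
  · push Not at h
    obtain ⟨j, hj⟩ := h
    rw [mul_zero]
    exact Finset.prod_eq_zero (Finset.mem_univ j) (if_neg (by omega))

end
end
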